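/- Let d = dim W_1 and let Q be the restriction to W_1 of the linear map α ↦ A_1 α (well-defined since W_1 is A_1-invariant), with characteristic polynomial P_Q. Then the linear network x(t+1) = A x(t) over F_p achieves synchronization if and only if the characteristic polynomial of A equals λ^{nm−d} · P_Q(λ). -/

import Mathlib

open Matrix Polynomial

/-- The i-th block row sum `A_i = ∑_{j=1}^n A_{ij}` of an n×n block matrix with m×m blocks. -/
def blockRowSum {p n m : ℕ} (A : Matrix (Fin n × Fin m) (Fin n × Fin m) (ZMod p))
    (i : Fin n) : Matrix (Fin m) (Fin m) (ZMod p) :=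
  Matrix.of fun a b => ∑ j : Fin n, A (i, a) (j, b)

/-- The subspace `W_1 = {α | (A_i - A_1) A_1^t α = 0, ∀ i = 2,…,n, ∀ t = 0,…,m-1}`,
realized as a submodule of `F_p^m` (an intersection of kernels). -/
def W1 {p n m : ℕ} [NeZero n] (A : Matrix (Fin n × Fin m) (Fin n × Fin m) (ZMod p)) :
    Submodule (ZMod p) (Fin m → ZMod p) :=
  ⨅ (i : Fin n) (_ : i ≠ 0) (t : Fin m),
    LinearMap.ker
      (Matrix.mulVecLin ((blockRowSum A i - blockRowSum A 0) * blockRowSum A 0 ^ (t : ℕ)))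

open Module.Basis in
theorem aux_charpoly_eq_mul {R V : Type*} [Field R] [AddCommGroup V]
    [Module R V] [Module.Finite R V] (W : Submodule R V)
    (e : V →ₗ[R] V) (he : W ≤ W.comap e) :
    e.charpoly = (e.restrict he).charpoly * (W.mapQ W e he).charpoly := by
  let m := Module.Free.ChooseBasisIndex R W
  let bW : Module.Basis m R W := Module.Free.chooseBasis R W
  let n := Module.Free.ChooseBasisIndex R (V ⧸ W)
  let bQ : Module.Basis n R (V ⧸ W) := Module.Free.chooseBasis R (V ⧸ W)
  let b := sumQuot bW bQ
  let A : Matrix m m R := LinearMap.toMatrix bW bW (e.restrict he)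
  let B : Matrix m n R := Matrix.of fun i l ↦
    ((sumQuot bW bQ).repr (e ((sumQuot bW bQ) (Sum.inr l)))) (Sum.inl i)
  let D : Matrix n n R := LinearMap.toMatrix bQ bQ (W.mapQ W e he)
  suffices LinearMap.toMatrix b b e = Matrix.fromBlocks A B 0 D by
    rw [← LinearMap.charpoly_toMatrix e b, this, ← LinearMap.charpoly_toMatrix _ bW,
      ← LinearMap.charpoly_toMatrix _ bQ, Matrix.charpoly_fromBlocks_zero₂₁]
  ext u v
  cases u with
  | inl i =>
    cases v with
    | inl k =>
      simp only [b, sumQuot_inl, Matrix.fromBlocks_apply₁₁, A, LinearMap.toMatrix_apply]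
      apply sumQuot_repr_inl_of_mem
    | inr l => simp [b, LinearMap.toMatrix_apply, Matrix.fromBlocks_apply₁₂, B]
  | inr j =>
    cases v with
    | inl k =>
      suffices W.mkQ (e (bW k)) = 0 by simp [LinearMap.toMatrix_apply, b, this]
      rw [← LinearMap.mem_ker, Submodule.ker_mkQ]
      exact he (Submodule.coe_mem (bW k))
    | inr l =>
      simp only [LinearMap.toMatrix_apply, sumQuot_repr_inr,
        Matrix.fromBlocks_apply₂₂, b, D]
      rw [← sumQuot_inr bW bQ l, W.mapQ_apply]
      simp

theorem aux_mulVec_diag {p n m : ℕ} (A : Matrix (Fin n × Fin m) (Fin n × Fin m) (ZMod p))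
    (α : Fin m → ZMod p) (i : Fin n) (a : Fin m) :
    (A *ᵥ (fun q => α q.2)) (i, a) = (blockRowSum A i *ᵥ α) a := by
  simp only [mulVec, dotProduct, blockRowSum, Matrix.of_apply, Fintype.sum_prod_type,
    Finset.sum_mul]
  rw [Finset.sum_comm]

theorem aux_mem_W1 {p n m : ℕ} [NeZero n]
    (A : Matrix (Fin n × Fin m) (Fin n × Fin m) (ZMod p)) (α : Fin m → ZMod p) :
    α ∈ W1 A ↔ ∀ i : Fin n, i ≠ 0 → ∀ t : Fin m,
      ((blockRowSum A i - blockRowSum A 0) * blockRowSum A 0 ^ (t : ℕ)) *ᵥ α = 0 := by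
  simp only [W1, Submodule.mem_iInf, LinearMap.mem_ker, Matrix.mulVecLin_apply]

/-- Theorem 2: Let `d = dim W_1` and let `Q` be the restriction to `W_1` of the
linear map `α ↦ A_1 α`, with characteristic polynomial `P_Q`. Then the network
`x(t+1) = A x(t)` over `F_p` achieves synchronization if and only if
`P_A(λ) = λ^{nm - d} · P_Q(λ)`. -/
theorem synchronization_iff_charpoly_general (p n m : ℕ) [Fact p.Prime] [NeZero n] [NeZero m]
    (A : Matrix (Fin n × Fin m) (Fin n × Fin m) (ZMod p))
    (Q : W1 A →ₗ[ZMod p] W1 A)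
    (hQ : ∀ x : W1 A, (Q x : Fin m → ZMod p) = blockRowSum A 0 *ᵥ (x : Fin m → ZMod p)) :
    (∀ x0 : Fin n × Fin m → ZMod p, ∃ T : ℕ, ∀ t ≥ T,
        ∀ i j : Fin n, ∀ a : Fin m, ((A ^ t) *ᵥ x0) (i, a) = ((A ^ t) *ᵥ x0) (j, a)) ↔
      A.charpoly = X ^ (n * m - Module.finrank (ZMod p) (W1 A)) * LinearMap.charpoly Q := by
  let Δ : (Fin m → ZMod p) →ₗ[ZMod p] (Fin n × Fin m → ZMod p) :=
    LinearMap.funLeft (ZMod p) (ZMod p) Prod.snd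
  have hΔ : Function.Injective Δ :=
    LinearMap.funLeft_injective_of_surjective _ _ _ Prod.snd_surjective
  have hΔa : ∀ α, Δ α = fun q => α q.2 := fun α => rfl
  let S := (W1 A).map Δ
  let f := A.mulVecLin
  have hfp : ∀ t x, (f ^ t) x = (A ^ t) *ᵥ x := by
    intro t x
    induction t generalizing x with
    | zero => simp
    | succ k ih => rw [pow_succ, Module.End.mul_apply, ih, pow_succ, ← mulVec_mulVec]; rfl
  have hfΔ : ∀ α : W1 A, f (Δ α) = Δ (Q α) := by
    intro α
    ext ⟨i, a⟩
    have h := (aux_mem_W1 A α.1).1 α.2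
    change (A *ᵥ (fun q : Fin n × Fin m => (α : Fin m → ZMod p) q.2)) (i, a)
      = (Q α : Fin m → ZMod p) a
    rw [aux_mulVec_diag, hQ]
    by_cases hi : i = 0
    · rw [hi]
    · have := h i hi 0
      simp [sub_mulVec, sub_eq_zero] at this
      rw [this]
  have hS : S ≤ S.comap f := by
    rintro _ ⟨α, hα, rfl⟩
    exact ⟨Q ⟨α, hα⟩, (Q ⟨α, hα⟩).2, (hfΔ ⟨α, hα⟩).symm⟩
  let e : W1 A ≃ₗ[ZMod p] S := Submodule.equivMapOfInjective Δ hΔ (W1 A)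
  have hconj : f.restrict hS = e.conj Q := by
    ext1 x
    obtain ⟨α, rfl⟩ := e.surjective x
    apply Subtype.ext
    rw [LinearEquiv.conj_apply_apply, e.symm_apply_apply]
    exact hfΔ α
  have hcp : A.charpoly = (S.mapQ S f hS).charpoly * Q.charpoly := by
    rw [← Matrix.charpoly_mulVecLin, aux_charpoly_eq_mul S f hS, hconj,
      LinearEquiv.charpoly_conj, mul_comm]
  have hdim : n * m - Module.finrank (ZMod p) (W1 A)
      = Module.finrank (ZMod p) ((Fin n × Fin m → ZMod p) ⧸ S) := by
    rw [e.finrank_eq, Submodule.finrank_quotient]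
    simp
  have hmq : ∀ t x, (S.mapQ S f hS ^ t) (S.mkQ x) = S.mkQ ((f ^ t) x) := by
    intro t x
    induction t generalizing x with
    | zero => simp
    | succ k ih => rw [pow_succ, Module.End.mul_apply, pow_succ, Module.End.mul_apply, ← ih]; rfl
  rw [hcp, hdim, mul_left_inj' Q.charpoly_monic.ne_zero, LinearMap.charpoly_eq_X_pow_iff]
  constructor
  · intro h y
    obtain ⟨x, rfl⟩ := S.mkQ_surjective y
    obtain ⟨T, hT⟩ := h x
    refine ⟨T, ?_⟩
    rw [hmq, ← LinearMap.mem_ker, Submodule.ker_mkQ, hfp]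
    let α : Fin m → ZMod p := fun a => ((A ^ T) *ᵥ x) (0, a)
    have key : ∀ k, (A ^ (T + k)) *ᵥ x = fun q => ((blockRowSum A 0 ^ k) *ᵥ α) q.2 := by
      intro k
      induction k with
      | zero =>
        ext ⟨i, a⟩
        simpa using hT T le_rfl i 0 a
      | succ k ih =>
        ext ⟨i, a⟩
        rw [hT (T + (k + 1)) (by omega) i 0 a, ← add_assoc, pow_succ', ← mulVec_mulVec, ih,
          aux_mulVec_diag, mulVec_mulVec, ← pow_succ']
    refine ⟨α, ?_, ?_⟩
    · refine (aux_mem_W1 A α).2 ?_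
      intro i _ t
      rw [← mulVec_mulVec, sub_mulVec, sub_eq_zero]
      ext a
      rw [← aux_mulVec_diag, ← aux_mulVec_diag, ← key, mulVec_mulVec, ← pow_succ']
      exact hT _ (by omega) i 0 a
    · have := key 0
      simp at this
      rw [this, hΔa]
  · intro h x
    obtain ⟨T, hT⟩ := h (S.mkQ x)
    refine ⟨T, fun t ht i j a => ?_⟩
    have h0 : (S.mapQ S f hS ^ t) (S.mkQ x) = 0 := by
      obtain ⟨k, rfl⟩ := Nat.exists_eq_add_of_le' ht
      rw [pow_add, Module.End.mul_apply, hT, map_zero]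
    rw [hmq, ← LinearMap.mem_ker, Submodule.ker_mkQ, hfp] at h0
    obtain ⟨α, _, hα⟩ := h0
    rw [← hα, hΔa]
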